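/- arXiv:2512.16286 — 2 statements merged into one kernel-verified Lean document; each statement's English description precedes it below -/
import Mathlib

section
/- Low-Mach-number limit for the two-phase one-velocity system with algebraic pressure closure (order-by-order form of Proposition 3.1). Let d ≥ 1, γ₊, γ₋ > 1 and μ, λ ∈ ℝ. Let α₊⁰, α₋⁰, α₊¹, α₋¹, ρ₊⁰, ρ₋⁰, ρ₊¹, ρ₋¹ : ℝ × ℝ^d → ℝ and u⁰ : ℝ × ℝ^d → ℝ^d be smooth ℤ^d-periodic functions with ρ₊⁰ > 0 and ρ₋⁰ > 0 everywhere, satisfying: (i) α₊⁰ + α₋⁰ = 1 and α₊¹ + α₋¹ = 0; (ii) (ρ₊⁰)^{γ₊} = (ρ₋⁰)^{γ₋} and γ₊(ρ₊⁰)^{γ₊−1}ρ₊¹ = γ₋(ρ₋⁰)^{γ₋−1}ρ₋¹; (iii) ∇(α₊⁰(ρ₊⁰)^{γ₊} + α₋⁰(ρ₋⁰)^{γ₋}) = 0; (iv) ∂ₜ(α₊⁰ρ₊⁰) + div(α₊⁰ρ₊⁰u⁰) = 0 and ∂ₜ(α₋⁰ρ₋⁰) + div(α₋⁰ρ₋⁰u⁰)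 = 0; (v) ∂ₜ((α₊⁰ρ₊⁰+α₋⁰ρ₋⁰)u⁰) + div((α₊⁰ρ₊⁰+α₋⁰ρ₋⁰)u⁰⊗u⁰) + ∇(α₊⁰γ₊(ρ₊⁰)^{γ₊−1}ρ₊¹ + α₋⁰γ₋(ρ₋⁰)^{γ₋−1}ρ₋¹ + α₊¹(ρ₊⁰)^{γ₊} + α₋¹(ρ₋⁰)^{γ₋}) = μΔu⁰ + (μ+λ)∇(div u⁰). Then: ρ₊⁰ and ρ₋⁰ are constant in space and time; div u⁰ = 0; ∂ₜα₊⁰ + u⁰·∇α₊⁰ = 0; and, setting π := γ₊(ρ₊⁰)^{γ₊−1}ρ₊¹, the limit momentum equation ∂ₜ((α₊⁰ρ₊⁰+α₋⁰ρ₋⁰)u⁰) + div((α₊⁰ρ₊⁰+α₋⁰ρ₋⁰)u⁰⊗u⁰) + ∇π = μΔu⁰ holds. -/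
open MeasureTheory Real

noncomputable section

/-- A space–time point: time in `ℝ`, space in `ℝ^d`. -/
abbrev Pt (d : ℕ) := ℝ × (Fin d → ℝ)

/-- Time derivative `∂ₜ f`. -/
def pt {d : ℕ} (f : Pt d → ℝ) (p : Pt d) : ℝ :=
  fderiv ℝ f p (1, 0)

/-- Spatial partial derivative `∂_{x i} f`. -/
def pd {d : ℕ} (i : Fin d) (f : Pt d → ℝ) (p : Pt d) : ℝ :=
  fderiv ℝ f p (0, Pi.single i 1)

/-- Spatial divergence of a vector field. -/
def divg {d : ℕ} (u : Pt d → Fin d → ℝ) (p : Pt d) : ℝ :=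
  ∑ i, pd i (fun q => u q i) p

/-- Spatial Laplacian of a scalar function. -/
def lap {d : ℕ} (f : Pt d → ℝ) (p : Pt d) : ℝ :=
  ∑ i, pd i (fun q => pd i f q) p

/-- `i`-th component of `div (r u ⊗ u)`, i.e. `∑ j ∂_{x j} (r u_i u_j)`. -/
def divT {d : ℕ} (r : Pt d → ℝ) (u : Pt d → Fin d → ℝ) (p : Pt d) (i : Fin d) : ℝ :=
  ∑ j, pd j (fun q => r q * u q i * u q j) p

/-- Symmetric gradient `D(u) = (∇u + (∇u)ᵀ)/2`. -/
def Dsym {d : ℕ} (u : Pt d → Fin d → ℝ) (p : Pt d) (i j : Fin d) : ℝ :=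
  (pd j (fun q => u q i) p + pd i (fun q => u q j) p) / 2

/-- Divergence of a matrix field, `i`-th component `∑ j ∂_{x j} M_{ij}`. -/
def divM {d : ℕ} (M : Pt d → Fin d → Fin d → ℝ) (p : Pt d) (i : Fin d) : ℝ :=
  ∑ j, pd j (fun q => M q i j) p

/-- `ℤ^d`-periodicity in the space variable. -/
def ZPeriodic {d : ℕ} (f : Pt d → ℝ) : Prop :=
  ∀ (k : Fin d → ℤ) (t : ℝ) (x : Fin d → ℝ), f (t, x + fun i => (k i : ℝ)) = f (t, x)

/-- `ℤ^d`-periodicity of a vector field. -/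
def ZPeriodicVec {d : ℕ} (u : Pt d → Fin d → ℝ) : Prop :=
  ∀ i, ZPeriodic (fun q => u q i)

/-- The unit cell `[0,1]^d`. -/
def cell (d : ℕ) : Set (Fin d → ℝ) := Set.Icc 0 1

lemma continuous_pt {d : ℕ} {F : Pt d → ℝ} (hF : ContDiff ℝ (⊤ : ℕ∞) F) : Continuous (pt F) :=
  (hF.continuous_fderiv (by simp)).clm_apply continuous_const

lemma continuous_pd {d : ℕ} {F : Pt d → ℝ} (hF : ContDiff ℝ (⊤ : ℕ∞) F) (i : Fin d) :
    Continuous (pd i F) :=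
  (hF.continuous_fderiv (by simp)).clm_apply continuous_const

lemma differentiable_of_smooth {d : ℕ} {F : Pt d → ℝ} (hF : ContDiff ℝ (⊤ : ℕ∞) F) :
    Differentiable ℝ F :=
  hF.differentiable (by simp)

lemma hasFDerivAt_space {d : ℕ} {F : Pt d → ℝ} (hF : Differentiable ℝ F)
    (t : ℝ) (x : Fin d → ℝ) :
    HasFDerivAt (fun y => F (t, y))
      ((fderiv ℝ F (t, x)).comp (ContinuousLinearMap.inr ℝ ℝ (Fin d → ℝ))) x :=
  (hF (t, x)).hasFDerivAt.comp x (hasFDerivAt_prodMk_right t x)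

lemma hasDerivAt_time {d : ℕ} {F : Pt d → ℝ} (hF : Differentiable ℝ F)
    (t : ℝ) (x : Fin d → ℝ) :
    HasDerivAt (fun s => F (s, x)) (pt F (t, x)) t := by
  have h := ((hF (t, x)).hasFDerivAt.comp t (hasFDerivAt_prodMk_left t x)).hasDerivAt
  simp only [ContinuousLinearMap.comp_apply, ContinuousLinearMap.inl_apply] at h
  exact h

lemma eq_of_pd_eq_zero {d : ℕ} {F : Pt d → ℝ} (hF : Differentiable ℝ F)
    (h : ∀ p i, pd i F p = 0) (t : ℝ) (x y : Fin d → ℝ) : F (t, x) = F (t, y) := by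
  refine is_const_of_fderiv_eq_zero (𝕜 := ℝ) (f := fun y => F (t, y))
    (fun z => (hasFDerivAt_space hF t z).differentiableAt) (fun z => ?_) x y
  rw [(hasFDerivAt_space hF t z).fderiv]
  apply ContinuousLinearMap.coe_injective
  refine LinearMap.pi_ext' fun i => LinearMap.ext_ring ?_
  simpa [pd] using h (t, z) i

lemma isCompact_cell (d : ℕ) : IsCompact (cell d) := isCompact_Icc

lemma measurableSet_cell (d : ℕ) : MeasurableSet (cell d) := measurableSet_Icc

lemma volume_real_cell (d : ℕ) : volume.real (cell d) = 1 := by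
  simp [cell, Measure.real, Real.volume_Icc_pi]

/-- The divergence of a periodic vector field has zero mean over the unit cell. -/
lemma integral_divg_cell {d : ℕ} {V : Pt d → Fin d → ℝ}
    (hV : ∀ i, ContDiff ℝ (⊤ : ℕ∞) (fun q => V q i)) (hper : ZPeriodicVec V) (t : ℝ) :
    ∫ x in cell d, divg V (t, x) = 0 := by
  cases d with
  | zero => simp [divg]
  | succ n =>
    have hcont : Continuous fun x => divg V (t, x) := by
      unfold divg
      exact continuous_finsetSum _ fun i _ =>
        (continuous_pd (hV i) i).comp (Continuous.prodMk_right t)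
    have key := integral_divergence_of_hasFDerivAt_off_countable'
      (0 : Fin (n + 1) → ℝ) 1 (fun _ => by simp)
      (fun i x => V (t, x) i)
      (fun i x => (fderiv ℝ (fun q => V q i) (t, x)).comp
        (ContinuousLinearMap.inr ℝ ℝ (Fin (n + 1) → ℝ))) ∅ Set.countable_empty
      (fun i => ((hV i).continuous.comp (Continuous.prodMk_right t)).continuousOn)
      (fun x _ i => hasFDerivAt_space (differentiable_of_smooth (hV i)) t x)
      (by
        refine ContinuousOn.integrableOn_compact isCompact_Icc (Continuous.continuousOn ?_)
        simpa [divg, pd] using hcont)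
    refine Eq.trans ?_ (key.trans ?_)
    · simp [divg, pd, cell]
    · refine Finset.sum_eq_zero fun i _ => sub_eq_zero.2 ?_
      congr 1
      funext x
      have h := hper i (Pi.single i 1) t (Fin.insertNth i 0 x)
      simp only [Pi.one_apply, Pi.zero_apply]
      refine Eq.trans ?_ h
      congr 3
      funext j
      refine Fin.succAboveCases i ?_ (fun k => ?_) j
      · simp
      · simp

/-- Differentiation of a cell average with respect to time. -/
lemma hasDerivAt_integral_cell {d : ℕ} {F : Pt d → ℝ} (hF : ContDiff ℝ (⊤ : ℕ∞) F) (t : ℝ) :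
    HasDerivAt (fun s => ∫ x in cell d, F (s, x)) (∫ x in cell d, pt F (t, x)) t := by
  obtain ⟨C, hC⟩ := ((isCompact_Icc (a := t - 1) (b := t + 1)).prod
    (isCompact_cell d)).exists_bound_of_continuousOn (continuous_pt hF).continuousOn
  have hc : ∀ s, Continuous fun x => F (s, x) := fun s =>
    hF.continuous.comp (Continuous.prodMk_right s)
  refine (hasDerivAt_integral_of_dominated_loc_of_deriv_le (bound := fun _ => C)
    (F' := fun s x => pt F (s, x))
    (Icc_mem_nhds (by linarith) (by linarith) : Set.Icc (t - 1) (t + 1) ∈ nhds t)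
    (Filter.Eventually.of_forall fun s => (hc s).aestronglyMeasurable)
    ((hc t).continuousOn.integrableOn_compact (isCompact_cell d))
    ((continuous_pt hF).comp (Continuous.prodMk_right t)).aestronglyMeasurable
    ?_ ?_ ?_).2
  · filter_upwards [ae_restrict_mem (measurableSet_cell d)] with x hx s hs
    exact hC (s, x) ⟨hs, hx⟩
  · exact continuousOn_const.integrableOn_compact (isCompact_cell d)
  · exact Filter.Eventually.of_forall fun x s _ =>
      hasDerivAt_time (differentiable_of_smooth hF) s x

/-- A quantity satisfying a periodic conservation law has constant cell average. -/
lemma integral_cell_eq_of_conservation {d : ℕ} {F : Pt d → ℝ} {V : Pt d → Fin d → ℝ}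
    (hF : ContDiff ℝ (⊤ : ℕ∞) F) (hV : ∀ i, ContDiff ℝ (⊤ : ℕ∞) (fun q => V q i))
    (hper : ZPeriodicVec V) (h : ∀ p, pt F p + divg V p = 0) (t s : ℝ) :
    ∫ x in cell d, F (t, x) = ∫ x in cell d, F (s, x) := by
  refine is_const_of_deriv_eq_zero (f := fun s => ∫ x in cell d, F (s, x))
    (fun r => (hasDerivAt_integral_cell hF r).differentiableAt) (fun r => ?_) t s
  rw [(hasDerivAt_integral_cell hF r).deriv]
  have hpt : (fun x => pt F (r, x)) = fun x => -divg V (r, x) :=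
    funext fun x => eq_neg_of_add_eq_zero_left (h (r, x))
  rw [hpt, integral_neg, integral_divg_cell hV hper, neg_zero]

/-- Two positive densities with equal power-law pressures and `c₁ / R + c₂ / S = 1` cannot
vary in time. -/
lemma deriv_eq_zero_of_conserved_masses {R S R' S' : ℝ → ℝ} {γ δ c₁ c₂ : ℝ}
    (hγ : 0 < γ) (hδ : 0 < δ)
    (hR : ∀ t, HasDerivAt R (R' t) t) (hS : ∀ t, HasDerivAt S (S' t) t)
    (hR0 : ∀ t, 0 < R t) (hS0 : ∀ t, 0 < S t) (hR' : Continuous R')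
    (hp : ∀ t, R t ^ γ = S t ^ δ) (hc : ∀ t, c₁ * S t + c₂ * R t = R t * S t) (t : ℝ) :
    R' t = 0 ∧ S' t = 0 := by
  have hlog : ∀ t, γ * (R' t * S t) = δ * (S' t * R t) := by
    intro t
    have h1 := ((hR t).log (hR0 t).ne').const_mul γ
    have h2 := ((hS t).log (hS0 t).ne').const_mul δ
    have he : (fun t => γ * log (R t)) = fun t => δ * log (S t) := by
      funext r
      rw [← log_rpow (hR0 r), ← log_rpow (hS0 r), hp]
    rw [he] at h1
    have h3 := h1.unique h2
    have := (hR0 t).ne'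
    have := (hS0 t).ne'
    field_simp at h3
    linarith
  have hder : ∀ t, c₁ * S' t + c₂ * R' t = R' t * S t + R t * S' t := by
    intro t
    have h1 := ((hS t).const_mul c₁).add ((hR t).const_mul c₂)
    have h2 := (hR t).mul (hS t)
    have he : ((fun t => c₁ * S t) + fun t => c₂ * R t) = R * S := funext hc
    rw [he] at h1
    exact h1.unique h2
  have hval : ∀ t, R' t ≠ 0 → R t = c₁ * (γ - δ) / γ := by
    intro t ht
    rw [eq_div_iff hγ.ne']
    have h : R' t * S t * (R t * γ - c₁ * (γ - δ)) = 0 := by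
      linear_combination (R t - c₁) * hlog t - δ * R t * hder t + δ * R' t * hc t
    rcases mul_eq_zero.1 h with h | h
    · exact absurd h (mul_ne_zero ht (hS0 t).ne')
    · linarith
  have hR'0 : R' t = 0 := by
    by_contra ht
    have hev : R =ᶠ[nhds t] fun _ => c₁ * (γ - δ) / γ :=
      (hR'.continuousAt.eventually_ne ht).mono hval
    exact ht ((hR t).unique ((hasDerivAt_const t _).congr_of_eventuallyEq hev))
  refine ⟨hR'0, ?_⟩
  have h := hlog t
  rw [hR'0] at h
  have : δ * R t * S' t = 0 := by linarith
  exact (mul_eq_zero.1 this).resolve_left (mul_pos hδ (hR0 t)).ne'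

lemma pt_mul_const {d : ℕ} {F : Pt d → ℝ} (hF : Differentiable ℝ F) (c : ℝ) (p : Pt d) :
    pt (fun q => F q * c) p = pt F p * c := by
  unfold pt
  rw [fderiv_mul_const (hF p)]
  simp [mul_comm]

lemma pd_mul {d : ℕ} {F G : Pt d → ℝ} (hF : Differentiable ℝ F) (hG : Differentiable ℝ G)
    (i : Fin d) (p : Pt d) :
    pd i (fun q => F q * G q) p = pd i F p * G p + F p * pd i G p := by
  unfold pd
  rw [fderiv_fun_mul (hF p) (hG p)]
  simp
  ring

/-- With constant density, mass conservation becomes transport of the volume fraction. -/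
lemma transport_of_mass_const {d : ℕ} {a : Pt d → ℝ} {u : Pt d → Fin d → ℝ} {R : ℝ}
    (ha : Differentiable ℝ a) (hu : ∀ i, Differentiable ℝ (fun q => u q i)) (hR : R ≠ 0)
    (h : ∀ p, pt (fun q => a q * R) p + divg (fun q j => a q * R * u q j) p = 0) (p : Pt d) :
    pt a p + ∑ i, u p i * pd i a p + a p * divg u p = 0 := by
  have h1 := h p
  rw [pt_mul_const ha] at h1
  have h2 : divg (fun q j => a q * R * u q j) p
      = (∑ i, u p i * pd i a p + a p * divg u p) * R := by
    unfold divg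
    rw [Finset.mul_sum, ← Finset.sum_add_distrib, Finset.sum_mul]
    refine Finset.sum_congr rfl fun i _ => ?_
    rw [pd_mul (ha.mul_const R) (hu i), pd_mul ha (differentiable_const R)]
    simp [pd]
    ring
  rw [h2] at h1
  refine (mul_eq_zero.1 ?_).resolve_right hR
  linarith

/-- low-Mach-number limit for the two-phase one-velocity system with
algebraic pressure closure (order-by-order form of Proposition 3.1). -/
theorem lowMach_twoPhase_oneVelocity_algebraic
    {d : ℕ} (hd : 1 ≤ d) (γp γm μ lam : ℝ) (hγp : 1 < γp) (hγm : 1 < γm)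
    (αp0 αm0 αp1 αm1 ρp0 ρm0 ρp1 ρm1 : Pt d → ℝ) (u0 : Pt d → Fin d → ℝ)
    (hreg : ContDiff ℝ (⊤ : ℕ∞) αp0 ∧ ContDiff ℝ (⊤ : ℕ∞) αm0 ∧ ContDiff ℝ (⊤ : ℕ∞) αp1 ∧ ContDiff ℝ (⊤ : ℕ∞) αm1 ∧
      ContDiff ℝ (⊤ : ℕ∞) ρp0 ∧ ContDiff ℝ (⊤ : ℕ∞) ρm0 ∧ ContDiff ℝ (⊤ : ℕ∞) ρp1 ∧ ContDiff ℝ (⊤ : ℕ∞) ρm1 ∧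
      ContDiff ℝ (⊤ : ℕ∞) u0)
    (hper : ZPeriodic αp0 ∧ ZPeriodic αm0 ∧ ZPeriodic αp1 ∧ ZPeriodic αm1 ∧
      ZPeriodic ρp0 ∧ ZPeriodic ρm0 ∧ ZPeriodic ρp1 ∧ ZPeriodic ρm1 ∧ ZPeriodicVec u0)
    (hρp : ∀ p, 0 < ρp0 p) (hρm : ∀ p, 0 < ρm0 p)
    -- (i)
    (hα0 : ∀ p, αp0 p + αm0 p = 1) (hα1 : ∀ p, αp1 p + αm1 p = 0)
    -- (ii)
    (hpeq0 : ∀ p, ρp0 p ^ γp = ρm0 p ^ γm)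
    (hpeq1 : ∀ p, γp * ρp0 p ^ (γp - 1) * ρp1 p = γm * ρm0 p ^ (γm - 1) * ρm1 p)
    -- (iii)
    (hgrad : ∀ p (i : Fin d),
      pd i (fun q => αp0 q * ρp0 q ^ γp + αm0 q * ρm0 q ^ γm) p = 0)
    -- (iv)
    (hmassp : ∀ p, pt (fun q => αp0 q * ρp0 q) p
      + divg (fun q j => αp0 q * ρp0 q * u0 q j) p = 0)
    (hmassm : ∀ p, pt (fun q => αm0 q * ρm0 q) p
      + divg (fun q j => αm0 q * ρm0 q * u0 q j) p = 0)
    -- (v)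
    (hmom : ∀ p (i : Fin d),
      pt (fun q => (αp0 q * ρp0 q + αm0 q * ρm0 q) * u0 q i) p
      + divT (fun q => αp0 q * ρp0 q + αm0 q * ρm0 q) u0 p i
      + pd i (fun q => αp0 q * (γp * ρp0 q ^ (γp - 1) * ρp1 q)
          + αm0 q * (γm * ρm0 q ^ (γm - 1) * ρm1 q)
          + αp1 q * ρp0 q ^ γp + αm1 q * ρm0 q ^ γm) p
      = μ * lap (fun q => u0 q i) p + (μ + lam) * pd i (divg u0) p) :
    -- conclusions
    (∀ p q : Pt d, ρp0 p = ρp0 q) ∧ (∀ p q : Pt d, ρm0 p = ρm0 q) ∧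
    (∀ p : Pt d, divg u0 p = 0) ∧
    (∀ p : Pt d, pt αp0 p + ∑ i, u0 p i * pd i αp0 p = 0) ∧
    (∀ p (i : Fin d),
      pt (fun q => (αp0 q * ρp0 q + αm0 q * ρm0 q) * u0 q i) p
      + divT (fun q => αp0 q * ρp0 q + αm0 q * ρm0 q) u0 p i
      + pd i (fun q => γp * ρp0 q ^ (γp - 1) * ρp1 q) p
      = μ * lap (fun q => u0 q i) p) := by
  obtain ⟨sαp, sαm, -, -, sρp, sρm, -, -, su⟩ := hreg
  obtain ⟨pαp, pαm, -, -, pρp, pρm, -, -, pu⟩ := hper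
  have su' : ∀ i, ContDiff ℝ (⊤ : ℕ∞) (fun q => u0 q i) := contDiff_pi.1 su
  have hpress : (fun q => αp0 q * ρp0 q ^ γp + αm0 q * ρm0 q ^ γm) = fun q => ρp0 q ^ γp := by
    funext q
    rw [← hpeq0, ← add_mul, hα0, one_mul]
  have hPd : Differentiable ℝ fun q => ρp0 q ^ γp := fun q =>
    (differentiable_of_smooth sρp q).rpow_const (Or.inl (hρp q).ne')
  have hPx : ∀ t x y, ρp0 (t, x) ^ γp = ρp0 (t, y) ^ γp :=
    eq_of_pd_eq_zero hPd fun p i => hpress ▸ hgrad p i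
  have hρpx : ∀ t x, ρp0 (t, x) = ρp0 (t, 0) := fun t x =>
    rpow_left_injOn (by linarith : γp ≠ 0) (hρp _).le (hρp _).le (hPx t x 0)
  have hρmx : ∀ t x, ρm0 (t, x) = ρm0 (t, 0) := fun t x =>
    rpow_left_injOn (by linarith : γm ≠ 0) (hρm _).le (hρm _).le
      (by simpa [hpeq0] using hPx t x 0)
  have flux : ∀ {a r : Pt d → ℝ}, ZPeriodic a → ZPeriodic r →
      ZPeriodicVec (fun q j => a q * r q * u0 q j) := by
    intro a r ha hr i k t x
    have := pu i k t x
    simp only [ha k t x, hr k t x, this]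
  have hmp := integral_cell_eq_of_conservation (sαp.mul sρp)
    (fun i => (sαp.mul sρp).mul (su' i)) (flux pαp pρp) hmassp
  have hmm := integral_cell_eq_of_conservation (sαm.mul sρm)
    (fun i => (sαm.mul sρm).mul (su' i)) (flux pαm pρm) hmassm
  have hint : ∀ {a : Pt d → ℝ}, ContDiff ℝ (⊤ : ℕ∞) a → ∀ t,
      IntegrableOn (fun x => a (t, x)) (cell d) := fun ha t =>
    (ha.continuous.comp (Continuous.prodMk_right t)).continuousOn.integrableOn_compact
      (isCompact_cell d)
  have hmass : ∀ t, (∫ x in cell d, αp0 (0, x) * ρp0 (0, x)) * ρm0 (t, 0)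
      + (∫ x in cell d, αm0 (0, x) * ρm0 (0, x)) * ρp0 (t, 0) = ρp0 (t, 0) * ρm0 (t, 0) := by
    intro t
    have hsum : (∫ x in cell d, αp0 (t, x)) + ∫ x in cell d, αm0 (t, x) = 1 := by
      rw [← integral_add (hint sαp t) (hint sαm t)]
      simp [hα0, volume_real_cell]
    rw [← hmp t 0, ← hmm t 0]
    simp only [hρpx t, hρmx t, integral_mul_const]
    linear_combination ρp0 (t, 0) * ρm0 (t, 0) * hsum
  have hderiv := deriv_eq_zero_of_conserved_masses (by linarith : 0 < γp) (by linarith : 0 < γm)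
    (fun t => hasDerivAt_time (differentiable_of_smooth sρp) t 0)
    (fun t => hasDerivAt_time (differentiable_of_smooth sρm) t 0)
    (fun t => hρp (t, 0)) (fun t => hρm (t, 0))
    ((continuous_pt sρp).comp (Continuous.prodMk_left 0)) (fun t => hpeq0 (t, 0)) hmass
  have const_time : ∀ {r : Pt d → ℝ}, ContDiff ℝ (⊤ : ℕ∞) r → (∀ t x, r (t, x) = r (t, 0)) →
      (∀ t, pt r (t, 0) = 0) → ∀ p q, r p = r q := by
    rintro r hr hx ht ⟨t, x⟩ ⟨s, y⟩
    rw [hx, hx s]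
    have hd := fun t => hasDerivAt_time (differentiable_of_smooth hr) t 0
    exact is_const_of_deriv_eq_zero (f := fun t => r (t, 0))
      (fun t => (hd t).differentiableAt) (fun t => (hd t).deriv.trans (ht t)) t s
  have hcp := const_time sρp hρpx fun t => (hderiv t).1
  have hcm := const_time sρm hρmx fun t => (hderiv t).2
  have dαp := differentiable_of_smooth sαp
  have dαm := differentiable_of_smooth sαm
  have du := fun i => differentiable_of_smooth (su' i)
  have htp := transport_of_mass_const (R := ρp0 0) dαp du (hρp 0).ne'
    (by simpa only [hcp _ 0] using hmassp)
  have htm := transport_of_mass_const (R := ρm0 0) dαm du (hρm 0).ne'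
    (by simpa only [hcm _ 0] using hmassm)
  have hαm : αm0 = fun q => 1 - αp0 q := funext fun q => by linarith [hα0 q]
  have hpt : ∀ p, pt αm0 p = -pt αp0 p := fun p => by simp [hαm, pt, fderiv_const_sub]
  have hpd : ∀ p i, pd i αm0 p = -pd i αp0 p := fun p i => by simp [hαm, pd, fderiv_const_sub]
  have hdiv : ∀ p, divg u0 p = 0 := by
    intro p
    have h2 := htm p
    simp only [hpt, hpd, mul_neg, Finset.sum_neg_distrib] at h2
    linear_combination htp p + h2 - divg u0 p * hα0 p
  refine ⟨hcp, hcm, hdiv, fun p => by simpa [hdiv p] using htp p, fun p i => ?_⟩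
  have hm := hmom p i
  have hπ : (fun q => αp0 q * (γp * ρp0 q ^ (γp - 1) * ρp1 q)
      + αm0 q * (γm * ρm0 q ^ (γm - 1) * ρm1 q)
      + αp1 q * ρp0 q ^ γp + αm1 q * ρm0 q ^ γm) = fun q => γp * ρp0 q ^ (γp - 1) * ρp1 q := by
    funext q
    rw [← hpeq1, ← hpeq0]
    linear_combination γp * ρp0 q ^ (γp - 1) * ρp1 q * hα0 q + ρp0 q ^ γp * hα1 q
  have hdiv0 : divg u0 = fun _ => 0 := funext hdiv
  rw [hπ, hdiv0] at hm
  simpa [pd] using hm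
end
end

section
/- Energy identity for the two-phase one-velocity system with algebraic pressure closure (equality form of estimate (3.2) for smooth periodic solutions with f = 0). Let d ≥ 1, γ₊, γ₋ > 1, λ₊, λ₋ ∈ ℝ, and let μ₊, μ₋ : (0,∞) → ℝ be smooth. Let α₊, α₋, ρ₊, ρ₋ : ℝ × ℝ^d → ℝ and u : ℝ × ℝ^d → ℝ^d be smooth ℤ^d-periodic functions with ρ₊ > 0, ρ₋ > 0, satisfying: α₊ + α₋ = 1; the mass equations ∂ₜ(α±ρ±) + div(α±ρ±u) = 0 for both phases; the algebraic closure ρ₊^{γ₊} = ρ₋^{γ₋}; and the momentum equation ∂ₜ((α₊ρ₊+α₋ρ₋)u) + div((α₊ρ₊+α₋ρ₋)u⊗u) + ∇(α₊ρ₊^{γ₊} + α₋ρ₋^{γ₋}) − 2 div((α₊μ₊(ρ₊)+α₋μ₋(ρ₋))D(u)) − ∇((α₊λ₊+α₋λ₋) div u) = 0. Then for every time t: d/dt ∫_{[0,1]^d} [ ½(α₊ρ₊+α₋ρ₋)|u|² + α₊ρ₊^{γ₊}/(γ₊−1) + α₋ρ₋^{γ₋}/(γ₋−1) ] dx + ∫_{[0,1]^d}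 [ 2(α₊μ₊(ρ₊)+α₋μ₋(ρ₋))|D(u)|² + (α₊λ₊+α₋λ₋)(div u)² ] dx = 0. -/
open MeasureTheory Real

noncomputable section

section Calculus

variable {d : ℕ}

lemma fderiv_mul_apply_eq {f g : Pt d → ℝ} {p : Pt d} (hf : DifferentiableAt ℝ f p)
    (hg : DifferentiableAt ℝ g p) (v : Pt d) :
    fderiv ℝ (fun q => f q * g q) p v = f p * fderiv ℝ g p v + g p * fderiv ℝ f p v := by
  rw [fderiv_fun_mul hf hg]
  simp

lemma fderiv_sum_apply_eq {ι : Type*} [Fintype ι] {f : ι → Pt d → ℝ} {p : Pt d}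
    (hf : ∀ i, DifferentiableAt ℝ (f i) p) (v : Pt d) :
    fderiv ℝ (fun q => ∑ i, f i q) p v = ∑ i, fderiv ℝ (f i) p v := by
  rw [fderiv_fun_sum fun i _ => hf i]
  simp

lemma contDiff_fderiv_apply {f : Pt d → ℝ} (hf : ContDiff ℝ (⊤ : ℕ∞) f) (v : Pt d) :
    ContDiff ℝ (⊤ : ℕ∞) fun p => fderiv ℝ f p v :=
  (hf.fderiv_right (by simp)).clm_apply contDiff_const

lemma contDiff_pd {f : Pt d → ℝ} (hf : ContDiff ℝ (⊤ : ℕ∞) f) (i : Fin d) :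
    ContDiff ℝ (⊤ : ℕ∞) (pd i f) :=
  contDiff_fderiv_apply hf _

lemma contDiff_divg {u : Pt d → Fin d → ℝ} (hu : ContDiff ℝ (⊤ : ℕ∞) u) :
    ContDiff ℝ (⊤ : ℕ∞) (divg u) :=
  ContDiff.sum fun i _ => contDiff_pd (contDiff_pi.1 hu i) i

lemma contDiff_Dsym {u : Pt d → Fin d → ℝ} (hu : ContDiff ℝ (⊤ : ℕ∞) u) (i j : Fin d) :
    ContDiff ℝ (⊤ : ℕ∞) fun p => Dsym u p i j :=
  ((contDiff_pd (contDiff_pi.1 hu i) j).add (contDiff_pd (contDiff_pi.1 hu j) i)).div_const 2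

lemma ZPeriodic.pd {f : Pt d → ℝ} (hf : ZPeriodic f) (i : Fin d) : ZPeriodic (pd i f) := by
  intro k t x
  have hshift : (fun q : Pt d => f (q + (0, fun i => (k i : ℝ)))) = f := by
    funext ⟨s, y⟩
    simpa using hf k s y
  have h := fderiv_comp_add_right (𝕜 := ℝ) (f := f) (x := (t, x)) (0, fun i => (k i : ℝ))
  rw [hshift] at h
  simp only [_root_.pd, h, Prod.mk_add_mk, add_zero]

lemma ZPeriodicVec.divg {u : Pt d → Fin d → ℝ} (hu : ZPeriodicVec u) : ZPeriodic (divg u) :=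
  fun k t x => Finset.sum_congr rfl fun i _ => (hu i).pd i k t x

lemma ZPeriodicVec.Dsym {u : Pt d → Fin d → ℝ} (hu : ZPeriodicVec u) (i j : Fin d) :
    ZPeriodic fun p => Dsym u p i j := by
  intro k t x
  have h₁ := (hu i).pd j k t x
  have h₂ := (hu j).pd i k t x
  simp only [_root_.Dsym, h₁, h₂]

end Calculus

section Integration

variable {d : ℕ}

/-- The divergence of a periodic field has zero mean over the unit cell. -/
lemma integral_divg_eq_zero {G : Pt d → Fin d → ℝ} (hG : ContDiff ℝ (⊤ : ℕ∞) G)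
    (hper : ZPeriodicVec G) (t : ℝ) : ∫ x in cell d, divg G (t, x) = 0 := by
  rcases d with _ | n
  · simp [divg]
  have hGi : ∀ i, Differentiable ℝ fun q => G q i := fun i =>
    (contDiff_pi.1 hG i).differentiable (by simp)
  have hslice : ∀ i x, HasFDerivAt (fun x => G (t, x) i)
      ((fderiv ℝ (fun q => G q i) (t, x)).comp
        (ContinuousLinearMap.inr ℝ ℝ (Fin (n + 1) → ℝ))) x := fun i x =>
    (hGi i (t, x)).hasFDerivAt.comp x (hasFDerivAt_prodMk_right t x)
  have hdiv : Continuous fun x : Fin (n + 1) → ℝ => divg G (t, x) :=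
    (contDiff_divg hG).continuous.comp (by fun_prop)
  have key := integral_divergence_of_hasFDerivAt_off_countable' (0 : Fin (n + 1) → ℝ) 1
    zero_le_one (fun i x => G (t, x) i) _ ∅ Set.countable_empty
    (fun i x _ => (hslice i x).continuousAt.continuousWithinAt)
    (fun x _ i => hslice i x)
    (hdiv.continuousOn.integrableOn_compact isCompact_Icc)
  refine key.trans (Finset.sum_eq_zero fun i _ => ?_)
  rw [sub_eq_zero]
  congr 1
  funext y
  have h := hper i (Pi.single i 1) t (Fin.insertNth i 0 y)
  simp only at h
  refine Eq.trans ?_ h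
  congr 2
  funext j
  refine Fin.succAboveCases i ?_ (fun j => ?_) j
  · simp
  · simp [Pi.single_apply, Fin.succAbove_ne]

lemma deriv_integral_cell {F : Pt d → ℝ} (hF : ContDiff ℝ (⊤ : ℕ∞) F) (t : ℝ) :
    deriv (fun s => ∫ x in cell d, F (s, x)) t = ∫ x in cell d, pt F (t, x) := by
  have hpt : Continuous (pt F) := (contDiff_fderiv_apply hF _).continuous
  have hF_slice : ∀ s, Continuous fun x => F (s, x) := fun s =>
    hF.continuous.comp (by fun_prop)
  have hcell : IsCompact (cell d) := isCompact_Icc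
  obtain ⟨C, hC⟩ := ((isCompact_Icc (a := t - 1) (b := t + 1)).prod
    hcell).exists_bound_of_continuousOn hpt.continuousOn
  have hfin : IsFiniteMeasure (volume.restrict (cell d)) :=
    ⟨by simpa using hcell.measure_lt_top⟩
  refine (hasDerivAt_integral_of_dominated_loc_of_deriv_le (bound := fun _ => C)
    (F' := fun s x => pt F (s, x)) (Icc_mem_nhds (sub_one_lt t) (lt_add_one t))
    (.of_forall fun s => (hF_slice s).aestronglyMeasurable)
    ((hF_slice t).continuousOn.integrableOn_compact hcell)
    (hpt.comp (by fun_prop : Continuous fun x => (t, x))).aestronglyMeasurable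
    ?_ (integrable_const C) (.of_forall fun x s _ => ?_)).2.deriv
  · filter_upwards [ae_restrict_mem isCompact_Icc.measurableSet] with x hx s hs
    exact hC (s, x) ⟨hs, hx⟩
  · exact ((hF.differentiable (by simp) (s, x)).hasFDerivAt.comp_hasDerivAt s
      ((hasDerivAt_id s).prodMk (hasDerivAt_const s x)))

end Integration

section LocalBalances

variable {d : ℕ} {u : Pt d → Fin d → ℝ} {p : Pt d}

lemma divg_smul {g : Pt d → ℝ} (hg : DifferentiableAt ℝ g p)
    (hu : ∀ i, DifferentiableAt ℝ (fun q => u q i) p) :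
    divg (fun q j => g q * u q j) p = ∑ i, u p i * pd i g p + g p * divg u p := by
  simp only [divg, pd, Finset.mul_sum, ← Finset.sum_add_distrib]
  refine Finset.sum_congr rfl fun i _ => ?_
  rw [fderiv_mul_apply_eq hg (hu i)]
  ring

lemma fderiv_half_mul_sq_apply {R w : Pt d → ℝ} (hR : DifferentiableAt ℝ R p)
    (hw : DifferentiableAt ℝ w p) (v : Pt d) :
    fderiv ℝ (fun q => R q * w q ^ 2 / 2) p v
      = w p * fderiv ℝ (fun q => R q * w q) p v - w p ^ 2 / 2 * fderiv ℝ R p v := by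
  have h : (fun q => R q * w q ^ 2 / 2) = fun q => (R q * w q) * (w q * (1 / 2)) := by
    funext q
    ring
  rw [h, fderiv_mul_apply_eq (hR.fun_mul hw) (hw.mul_const _), fderiv_mul_apply_eq hR hw,
    fderiv_mul_apply_eq hw (differentiableAt_const _)]
  simp
  ring

/-- Balance of kinetic energy along a flow that conserves the mass `R`. -/
lemma kinetic_energy_balance {R : Pt d → ℝ} (hR : DifferentiableAt ℝ R p)
    (hu : ∀ i, DifferentiableAt ℝ (fun q => u q i) p)
    (hmass : pt R p + divg (fun q j => R q * u q j) p = 0) :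
    pt (fun q => (1 / 2) * R q * ∑ i, u q i ^ 2) p
        + divg (fun q j => (1 / 2) * R q * (∑ i, u q i ^ 2) * u q j) p
      = ∑ i, u p i * (pt (fun q => R q * u q i) p + divT R u p i) := by
  have h₁ : (fun q => (1 / 2) * R q * ∑ i, u q i ^ 2)
      = fun q => ∑ i, R q * u q i ^ 2 / 2 := by
    funext q
    rw [Finset.mul_sum]
    exact Finset.sum_congr rfl fun i _ => by ring
  have h₂ : ∀ j, (fun q => (1 / 2) * R q * (∑ i, u q i ^ 2) * u q j)
      = fun q => ∑ i, (R q * u q j) * u q i ^ 2 / 2 := by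
    intro j
    funext q
    rw [Finset.mul_sum, Finset.sum_mul]
    exact Finset.sum_congr rfl fun i _ => by ring
  simp only [pt, divg, pd, divT] at hmass ⊢
  simp only [h₁, h₂]
  rw [fderiv_sum_apply_eq fun i => by fun_prop]
  simp_rw [fun j => fderiv_sum_apply_eq (p := p) (f := fun i q => R q * u q j * u q i ^ 2 / 2)
    fun i => by fun_prop]
  rw [Finset.sum_comm, ← Finset.sum_add_distrib]
  refine Finset.sum_congr rfl fun i _ => ?_
  simp_rw [fderiv_half_mul_sq_apply hR (hu i),
    fun j => fderiv_half_mul_sq_apply (hR.fun_mul (hu j)) (hu i), Finset.sum_sub_distrib,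
    ← Finset.mul_sum]
  have h₃ : ∀ j, (fun q => R q * u q j * u q i) = fun q => R q * u q i * u q j := fun j =>
    funext fun q => mul_right_comm _ _ _
  rw [Finset.sum_congr rfl fun j _ => by rw [h₃ j]]
  linear_combination (-(u p i ^ 2 / 2)) * hmass

lemma fderiv_phase_energy_apply {α ρ : Pt d → ℝ} {γ : ℝ} (hγ : 1 < γ)
    (hα : DifferentiableAt ℝ α p) (hρ : DifferentiableAt ℝ ρ p) (hpos : 0 < ρ p) (v : Pt d) :
    fderiv ℝ (fun q => α q * ρ q ^ γ / (γ - 1)) p v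
      = γ / (γ - 1) * ρ p ^ (γ - 1) * fderiv ℝ (fun q => α q * ρ q) p v
        - ρ p ^ γ * fderiv ℝ α p v := by
  have hpow : HasFDerivAt (fun q => ρ q ^ γ) ((γ * ρ p ^ (γ - 1)) • fderiv ℝ ρ p) p :=
    hρ.hasFDerivAt.rpow_const (.inl hpos.ne')
  have h : (fun q => α q * ρ q ^ γ / (γ - 1)) = fun q => (α q * ρ q ^ γ) * (γ - 1)⁻¹ := by
    funext q
    ring
  have hγ' : γ - 1 ≠ 0 := by linarith
  have hsplit : ρ p ^ γ = ρ p ^ (γ - 1) * ρ p := by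
    rw [← Real.rpow_add_one hpos.ne']
    simp
  rw [h, fderiv_mul_apply_eq (hα.fun_mul hpow.differentiableAt) (differentiableAt_const _),
    fderiv_mul_apply_eq hα hpow.differentiableAt, hpow.fderiv, fderiv_mul_apply_eq hα hρ, hsplit]
  simp
  field_simp
  ring

/-- Balance of internal energy of one phase transported by the flow. -/
lemma phase_energy_balance {α ρ : Pt d → ℝ} {γ : ℝ} (hγ : 1 < γ)
    (hα : DifferentiableAt ℝ α p) (hρ : DifferentiableAt ℝ ρ p) (hpos : 0 < ρ p)
    (hu : ∀ i, DifferentiableAt ℝ (fun q => u q i) p)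
    (hmass : pt (fun q => α q * ρ q) p + divg (fun q j => α q * ρ q * u q j) p = 0) :
    pt (fun q => α q * ρ q ^ γ / (γ - 1)) p
        + divg (fun q j => α q * ρ q ^ γ / (γ - 1) * u q j) p
      = -(ρ p ^ γ * (pt α p + ∑ i, u p i * pd i α p + α p * divg u p)) := by
  have hγ' : γ - 1 ≠ 0 := by linarith
  have hsplit : ρ p ^ γ = ρ p ^ (γ - 1) * ρ p := by
    rw [← Real.rpow_add_one hpos.ne']
    simp
  have hE : DifferentiableAt ℝ (fun q => α q * ρ q ^ γ / (γ - 1)) p :=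
    by
    simpa only [div_eq_mul_inv] using
      (hα.fun_mul (hρ.rpow_const (.inl hpos.ne'))).mul_const (γ - 1)⁻¹
  rw [divg_smul (g := fun q => α q * ρ q) (hα.mul hρ) hu] at hmass
  rw [divg_smul hE hu]
  simp only [pt, pd] at hmass ⊢
  simp_rw [fderiv_phase_energy_apply hγ hα hρ hpos, mul_sub, Finset.sum_sub_distrib]
  have h₁ : ∑ i, u p i * (γ / (γ - 1) * ρ p ^ (γ - 1)
        * fderiv ℝ (fun q => α q * ρ q) p (0, Pi.single i 1))
      = γ / (γ - 1) * ρ p ^ (γ - 1)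
        * ∑ i, u p i * fderiv ℝ (fun q => α q * ρ q) p (0, Pi.single i 1) := by
    rw [Finset.mul_sum]
    exact Finset.sum_congr rfl fun i _ => by ring
  have h₂ : ∑ i, u p i * (ρ p ^ γ * fderiv ℝ α p (0, Pi.single i 1))
      = ρ p ^ γ * ∑ i, u p i * fderiv ℝ α p (0, Pi.single i 1) := by
    rw [Finset.mul_sum]
    exact Finset.sum_congr rfl fun i _ => by ring
  have h₃ : α p * ρ p ^ γ / (γ - 1)
      = γ / (γ - 1) * ρ p ^ (γ - 1) * (α p * ρ p) - ρ p ^ γ * α p := by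
    rw [hsplit]
    field_simp
    ring
  rw [h₁, h₂, h₃]
  linear_combination (γ / (γ - 1) * ρ p ^ (γ - 1)) * hmass

/-- The power of the viscous stress splits into a divergence and the dissipation. -/
lemma viscous_power {ν : Pt d → ℝ} (hν : DifferentiableAt ℝ ν p)
    (hu : ContDiff ℝ (⊤ : ℕ∞) u) :
    divg (fun q j => ∑ i, ν q * Dsym u q i j * u q i) p
      = ∑ i, u p i * divM (fun q i j => ν q * Dsym u q i j) p i
        + ν p * ∑ i, ∑ j, Dsym u p i j ^ 2 := by
  have hui : ∀ i, DifferentiableAt ℝ (fun q => u q i) p := fun i =>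
    (contDiff_pi.1 hu i).differentiable (by simp) p
  have hS : ∀ i j, DifferentiableAt ℝ (fun q => ν q * Dsym u q i j) p := fun i j =>
    hν.mul ((contDiff_Dsym hu i j).differentiable (by simp) p)
  have hsymm : ∑ i, ∑ j, Dsym u p i j ^ 2
      = ∑ i, ∑ j, Dsym u p i j * pd j (fun q => u q i) p := by
    have hcomm : ∑ i, ∑ j, Dsym u p i j * pd i (fun q => u q j) p
        = ∑ i, ∑ j, Dsym u p i j * pd j (fun q => u q i) p := by
      rw [Finset.sum_comm]
      refine Finset.sum_congr rfl fun i _ => Finset.sum_congr rfl fun j _ => ?_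
      rw [show Dsym u p j i = Dsym u p i j by simp only [Dsym, add_comm]]
    have hsq : ∑ i, ∑ j, Dsym u p i j ^ 2
        = (∑ i, ∑ j, Dsym u p i j * pd j (fun q => u q i) p
          + ∑ i, ∑ j, Dsym u p i j * pd i (fun q => u q j) p) / 2 := by
      simp only [← Finset.sum_add_distrib, Finset.sum_div]
      refine Finset.sum_congr rfl fun i _ => Finset.sum_congr rfl fun j _ => ?_
      rw [sq]
      nth_rewrite 2 [Dsym]
      ring
    rw [hsq, hcomm]
    ring
  rw [hsymm]
  simp only [divg, divM, pd, Finset.mul_sum, ← Finset.sum_add_distrib]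
  simp_rw [fun j => fderiv_sum_apply_eq (p := p) (f := fun i q => ν q * Dsym u q i j * u q i)
    fun i => (hS i j).mul (hui i)]
  rw [Finset.sum_comm]
  refine Finset.sum_congr rfl fun i _ => Finset.sum_congr rfl fun j _ => ?_
  rw [fderiv_mul_apply_eq (hS i j) (hui i)]
  ring

end LocalBalances

/-- energy identity for the two-phase one-velocity system with algebraic
pressure closure (equality form of estimate (3.2), `f = 0`, smooth periodic solutions). -/
theorem energy_identity_algebraic_closure
    {d : ℕ} (hd : 1 ≤ d) (γp γm lamp lamm : ℝ) (hγp : 1 < γp) (hγm : 1 < γm)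
    (μp μm : ℝ → ℝ)
    (hμp : ContDiffOn ℝ (⊤ : ℕ∞) μp (Set.Ioi 0)) (hμm : ContDiffOn ℝ (⊤ : ℕ∞) μm (Set.Ioi 0))
    (αp αm ρp ρm : Pt d → ℝ) (u : Pt d → Fin d → ℝ)
    (hreg : ContDiff ℝ (⊤ : ℕ∞) αp ∧ ContDiff ℝ (⊤ : ℕ∞) αm ∧ ContDiff ℝ (⊤ : ℕ∞) ρp ∧ ContDiff ℝ (⊤ : ℕ∞) ρm ∧
      ContDiff ℝ (⊤ : ℕ∞) u)
    (hper : ZPeriodic αp ∧ ZPeriodic αm ∧ ZPeriodic ρp ∧ ZPeriodic ρm ∧ ZPeriodicVec u)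
    (hρp : ∀ p, 0 < ρp p) (hρm : ∀ p, 0 < ρm p)
    (hα : ∀ p, αp p + αm p = 1)
    (hmassp : ∀ p, pt (fun q => αp q * ρp q) p
      + divg (fun q j => αp q * ρp q * u q j) p = 0)
    (hmassm : ∀ p, pt (fun q => αm q * ρm q) p
      + divg (fun q j => αm q * ρm q * u q j) p = 0)
    (hclosure : ∀ p, ρp p ^ γp = ρm p ^ γm)
    (hmom : ∀ p (i : Fin d),
      pt (fun q => (αp q * ρp q + αm q * ρm q) * u q i) p
      + divT (fun q => αp q * ρp q + αm q * ρm q) u p i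
      + pd i (fun q => αp q * ρp q ^ γp + αm q * ρm q ^ γm) p
      - 2 * divM (fun q i j => (αp q * μp (ρp q) + αm q * μm (ρm q)) * Dsym u q i j) p i
      - pd i (fun q => (αp q * lamp + αm q * lamm) * divg u q) p = 0) :
    ∀ t : ℝ,
      deriv (fun s => ∫ x in cell d,
          ((1 / 2) * (αp (s, x) * ρp (s, x) + αm (s, x) * ρm (s, x))
              * ∑ i, (u (s, x) i) ^ 2
            + αp (s, x) * ρp (s, x) ^ γp / (γp - 1)
            + αm (s, x) * ρm (s, x) ^ γm / (γm - 1))) t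
      + (∫ x in cell d,
          (2 * (αp (t, x) * μp (ρp (t, x)) + αm (t, x) * μm (ρm (t, x)))
              * ∑ i, ∑ j, (Dsym u (t, x) i j) ^ 2
            + (αp (t, x) * lamp + αm (t, x) * lamm) * (divg u (t, x)) ^ 2)) = 0 := by
  intro t
  obtain ⟨hαp, hαm, hρp_smooth, hρm_smooth, hu⟩ := hreg
  obtain ⟨hαp_per, hαm_per, hρp_per, hρm_per, hu_per⟩ := hper
  have hui : ∀ i, ContDiff ℝ (⊤ : ℕ∞) fun q => u q i := contDiff_pi.1 hu
  have diff : ∀ {f : Pt d → ℝ}, ContDiff ℝ (⊤ : ℕ∞) f → ∀ p, DifferentiableAt ℝ f p :=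
    fun hf p => hf.differentiable (by simp) p
  set R : Pt d → ℝ := fun q => αp q * ρp q + αm q * ρm q with hR_def
  set P : Pt d → ℝ := fun q => αp q * ρp q ^ γp + αm q * ρm q ^ γm with hP_def
  set ν : Pt d → ℝ := fun q => αp q * μp (ρp q) + αm q * μm (ρm q)
  set L : Pt d → ℝ := fun q => αp q * lamp + αm q * lamm
  set K : Pt d → ℝ := fun q => (1 / 2) * R q * ∑ i, u q i ^ 2
  set Ep : Pt d → ℝ := fun q => αp q * ρp q ^ γp / (γp - 1)
  set Em : Pt d → ℝ := fun q => αm q * ρm q ^ γm / (γm - 1)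
  set V : Pt d → Fin d → ℝ := fun q j => ∑ i, ν q * Dsym u q i j * u q i
  set W : Pt d → Fin d → ℝ := fun q j => L q * divg u q * u q j
  have hpowp : ContDiff ℝ (⊤ : ℕ∞) fun q => ρp q ^ γp :=
    hρp_smooth.rpow_const_of_ne fun q => (hρp q).ne'
  have hpowm : ContDiff ℝ (⊤ : ℕ∞) fun q => ρm q ^ γm :=
    hρm_smooth.rpow_const_of_ne fun q => (hρm q).ne'
  have hR : ContDiff ℝ (⊤ : ℕ∞) R := (hαp.mul hρp_smooth).add (hαm.mul hρm_smooth)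
  have hP : ContDiff ℝ (⊤ : ℕ∞) P := (hαp.mul hpowp).add (hαm.mul hpowm)
  have hν : ContDiff ℝ (⊤ : ℕ∞) ν :=
    (hαp.mul (hμp.comp_contDiff hρp_smooth hρp)).add
      (hαm.mul (hμm.comp_contDiff hρm_smooth hρm))
  have hL : ContDiff ℝ (⊤ : ℕ∞) L := (hαp.mul contDiff_const).add (hαm.mul contDiff_const)
  have hK : ContDiff ℝ (⊤ : ℕ∞) K :=
    (contDiff_const.mul hR).mul (ContDiff.sum fun i _ => (hui i).pow 2)
  have hEp : ContDiff ℝ (⊤ : ℕ∞) Ep := (hαp.mul hpowp).div_const _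
  have hEm : ContDiff ℝ (⊤ : ℕ∞) Em := (hαm.mul hpowm).div_const _
  have hV : ∀ j, ContDiff ℝ (⊤ : ℕ∞) fun q => V q j := fun j =>
    ContDiff.sum fun i _ => (hν.mul (contDiff_Dsym hu i j)).mul (hui i)
  have hw : ContDiff ℝ (⊤ : ℕ∞) (divg u) := contDiff_divg hu
  have hW : ∀ j, ContDiff ℝ (⊤ : ℕ∞) fun q => W q j := fun j => (hL.mul hw).mul (hui j)
  -- the energy flux
  let G : Pt d → Fin d → ℝ := fun q j =>
    K q * u q j + Ep q * u q j + Em q * u q j + P q * u q j - 2 * V q j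
      - W q j
  have hG : ContDiff ℝ (⊤ : ℕ∞) G := contDiff_pi.2 fun j =>
    (((((hK.mul (hui j)).add (hEp.mul (hui j))).add (hEm.mul (hui j))).add
      (hP.mul (hui j))).sub (contDiff_const.mul (hV j))).sub (hW j)
  have hG_per : ZPeriodicVec G := by
    intro j k s x
    have hu' := fun i => hu_per i k s x
    have hD := fun i => hu_per.Dsym i j k s x
    simp only [G, W, K, Ep, Em, P, V, L, ν, R, hαp_per k s x, hαm_per k s x, hρp_per k s x,
      hρm_per k s x, hu_per.divg k s x] at hu' hD ⊢
    simp only [hu', hD]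
  have hdivG : ∀ p, divg G p = divg (fun q j => K q * u q j) p
      + divg (fun q j => Ep q * u q j) p + divg (fun q j => Em q * u q j) p
      + divg (fun q j => P q * u q j) p - 2 * divg V p
      - divg W p := by
    intro p
    simp only [divg, Finset.mul_sum, ← Finset.sum_add_distrib, ← Finset.sum_sub_distrib]
    refine Finset.sum_congr rfl fun j _ => ?_
    have h₁ := (diff (hK.mul (hui j)) p).hasFDerivAt
    have h₂ := (diff (hEp.mul (hui j)) p).hasFDerivAt
    have h₃ := (diff (hEm.mul (hui j)) p).hasFDerivAt
    have h₄ := (diff (hP.mul (hui j)) p).hasFDerivAt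
    have h₅ := (diff (hV j) p).hasFDerivAt.const_mul 2
    have h₆ := (diff (hW j) p).hasFDerivAt
    have h := (((((h₁.fun_add h₂).fun_add h₃).fun_add h₄).fun_sub h₅).fun_sub h₆).fderiv
    exact (congrArg (fun A : Pt d →L[ℝ] ℝ => A (0, Pi.single j 1)) h).trans (by simp [pd])
  have hF : ContDiff ℝ (⊤ : ℕ∞) fun q => K q + Ep q + Em q := (hK.add hEp).add hEm
  have hlocal : ∀ p, pt (fun q => K q + Ep q + Em q) p
      = -(2 * ν p * ∑ i, ∑ j, Dsym u p i j ^ 2 + L p * divg u p ^ 2) - divg G p := by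
    intro p
    have hud := fun i => diff (hui i) p
    have hptF : pt (fun q => K q + Ep q + Em q) p = pt K p + pt Ep p + pt Em p := by
      simp only [pt]
      rw [fderiv_fun_add ((diff hK p).fun_add (diff hEp p)) (diff hEm p),
        fderiv_fun_add (diff hK p) (diff hEp p)]
      simp
    have hmass : pt R p + divg (fun q j => R q * u q j) p = 0 := by
      have hp := hmassp p
      have hm := hmassm p
      have hap := diff (hαp.mul hρp_smooth) p
      have ham := diff (hαm.mul hρm_smooth) p
      rw [divg_smul (g := fun q => αp q * ρp q) hap hud] at hp
      rw [divg_smul (g := fun q => αm q * ρm q) ham hud] at hm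
      rw [divg_smul (diff hR p) hud]
      have hRf : fderiv ℝ R p = fderiv ℝ (fun q => αp q * ρp q) p
          + fderiv ℝ (fun q => αm q * ρm q) p := fderiv_fun_add hap ham
      simp only [pt, pd, hRf, add_apply, mul_add,
        Finset.sum_add_distrib] at hp hm ⊢
      simp only [hR_def]
      linear_combination hp + hm
    have hkin : pt K p + divg (fun q j => K q * u q j) p
        = ∑ i, u p i * (pt (fun q => R q * u q i) p + divT R u p i) :=
      kinetic_energy_balance (diff hR p) hud hmass
    have hintp := phase_energy_balance hγp (diff hαp p) (diff hρp_smooth p) (hρp p) hud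
      (hmassp p)
    have hintm := phase_energy_balance hγm (diff hαm p) (diff hρm_smooth p) (hρm p) hud
      (hmassm p)
    have hdα : fderiv ℝ αm p = -fderiv ℝ αp p := by
      rw [show αm = fun q => 1 - αp q from funext fun q => by linarith [hα q], fderiv_const_sub]
    have hPp : P p = ρp p ^ γp := by
      simp only [hP_def, ← hclosure p]
      linear_combination ρp p ^ γp * hα p
    have hint : pt Ep p + divg (fun q j => Ep q * u q j) p
        + (pt Em p + divg (fun q j => Em q * u q j) p) = -(P p * divg u p) := by
      refine (congrArg₂ (· + ·) hintp hintm).trans ?_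
      simp only [pt, pd, hdα, neg_apply, mul_neg, Finset.sum_neg_distrib,
        ← hclosure p, hPp]
      linear_combination (-(ρp p ^ γp * divg u p)) * hα p
    have hpress := divg_smul (diff hP p) hud
    have hbulk : divg W p = _ := divg_smul (diff (hL.mul hw) p) hud
    have hvisc : divg V p = _ := viscous_power (diff hν p) hu
    have hpower : ∑ i, u p i * (pt (fun q => R q * u q i) p + divT R u p i)
        + ∑ i, u p i * pd i P p
        - 2 * ∑ i, u p i * divM (fun q i j => ν q * Dsym u q i j) p i
        - ∑ i, u p i * pd i (fun q => L q * divg u q) p = 0 := by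
      simp only [Finset.mul_sum, ← Finset.sum_add_distrib, ← Finset.sum_sub_distrib]
      refine Finset.sum_eq_zero fun i _ => ?_
      linear_combination u p i * hmom p i
    rw [hptF, hdivG p]
    linear_combination hkin + hint + hpress - 2 * hvisc - hbulk + hpower
  have hdiss : Continuous fun x : Fin d → ℝ =>
      2 * ν (t, x) * ∑ i, ∑ j, Dsym u (t, x) i j ^ 2 + L (t, x) * divg u (t, x) ^ 2 := by
    have h : ContDiff ℝ (⊤ : ℕ∞) fun q =>
        2 * ν q * ∑ i, ∑ j, Dsym u q i j ^ 2 + L q * divg u q ^ 2 :=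
      ((contDiff_const.mul hν).mul (ContDiff.sum fun i _ => ContDiff.sum fun j _ =>
        (contDiff_Dsym hu i j).pow 2)).add (hL.mul (hw.pow 2))
    exact h.continuous.comp (by fun_prop : Continuous fun x : Fin d → ℝ => (t, x))
  have hdivG_cont : Continuous fun x : Fin d → ℝ => divg G (t, x) :=
    (contDiff_divg hG).continuous.comp (by fun_prop)
  have hcell : IsCompact (cell d) := isCompact_Icc
  have hderiv := deriv_integral_cell hF t
  simp only [hlocal] at hderiv
  rw [integral_sub (hdiss.fun_neg.continuousOn.integrableOn_compact hcell)
    (hdivG_cont.continuousOn.integrableOn_compact hcell), integral_divg_eq_zero hG hG_per,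
    integral_neg, sub_zero] at hderiv
  exact (congrArg (· + _) hderiv).trans (neg_add_cancel _)
end
end
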